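/- Let P and P' be Petri nets with transition sets T, T' and place sets S, S', and let P + P' be their coproduct Petri net, with transition set T ⊔ T', place set S ⊔ S', and sources and targets induced from those of P and P' via the inclusions. Identify ℕ[S ⊔ S'] with ℕ[S] × ℕ[S'] via the canonical monoid isomorphism. Then a marking (n, n') is reachable from a marking (m, m') in P + P' if and only if n is reachable from m in P and n' is reachable from m' in P'. -/

import Mathlib

universe u

structure PetriNet : Type (u + 1) where
  T : Type u
  S : Type u
  src : T → Multiset S
  tgt : T → Multiset S

def PetriNet.Fires (P : PetriNet.{u}) (τ : P.T) (m n : Multiset P.S) : Prop :=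
  P.src τ ≤ m ∧ n + P.src τ = m + P.tgt τ

inductive PetriNet.Reachable (P : PetriNet.{u}) : Multiset P.S → Multiset P.S → Prop
  | refl (m : Multiset P.S) : PetriNet.Reachable P m m
  | step {m m' n : Multiset P.S} (τ : P.T) :
      P.Fires τ m m' → PetriNet.Reachable P m' n → PetriNet.Reachable P m n

/-- The coproduct `P + P'` of two Petri nets: transitions `T ⊔ T'`, places `S ⊔ S'`,
sources and targets induced via the inclusions. -/
def PetriNet.coprod (P P' : PetriNet.{u}) : PetriNet.{u} where
  T := P.T ⊕ P'.T
  S := P.S ⊕ P'.S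
  src := Sum.elim (fun τ => (P.src τ).map Sum.inl) (fun τ => (P'.src τ).map Sum.inr)
  tgt := Sum.elim (fun τ => (P.tgt τ).map Sum.inl) (fun τ => (P'.tgt τ).map Sum.inr)

namespace Multiset

variable {α β : Type*}

theorem filterMap_getLeft?_map_inl (s : Multiset α) :
    (s.map (Sum.inl : α → α ⊕ β)).filterMap Sum.getLeft? = s := by
  induction s using Multiset.induction <;> simp_all

theorem filterMap_getLeft?_map_inr (s : Multiset β) :
    (s.map (Sum.inr : β → α ⊕ β)).filterMap Sum.getLeft? = 0 := by
  induction s using Multiset.induction <;>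
    simp_all [Multiset.filterMap_cons]

theorem filterMap_getRight?_map_inl (s : Multiset α) :
    (s.map (Sum.inl : α → α ⊕ β)).filterMap Sum.getRight? = 0 := by
  induction s using Multiset.induction <;>
    simp_all [Multiset.filterMap_cons]

theorem filterMap_getRight?_map_inr (s : Multiset β) :
    (s.map (Sum.inr : β → α ⊕ β)).filterMap Sum.getRight? = s := by
  induction s using Multiset.induction <;> simp_all

theorem filterMap_getLeft?_map_inl_add_map_inr (s : Multiset α) (t : Multiset β) :
    (s.map Sum.inl + t.map Sum.inr).filterMap Sum.getLeft? = s := by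
  rw [filterMap_add, filterMap_getLeft?_map_inl, filterMap_getLeft?_map_inr, add_zero]

theorem filterMap_getRight?_map_inl_add_map_inr (s : Multiset α) (t : Multiset β) :
    (s.map Sum.inl + t.map Sum.inr).filterMap Sum.getRight? = t := by
  rw [filterMap_add, filterMap_getRight?_map_inl, filterMap_getRight?_map_inr, zero_add]

end Multiset

namespace PetriNet

variable {P : PetriNet.{u}}

theorem Reachable.trans {l m n : Multiset P.S} (h : P.Reachable l m) (h' : P.Reachable m n) :
    P.Reachable l n := by
  induction h with
  | refl => exact h'
  | step τ hf _ ih => exact .step τ hf (ih h')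

theorem Fires.add_right {τ : P.T} {m n : Multiset P.S} (h : P.Fires τ m n) (k : Multiset P.S) :
    P.Fires τ (m + k) (n + k) :=
  ⟨h.1.trans (Multiset.le_add_right m k), by
    rw [add_right_comm, h.2, add_right_comm]⟩

theorem Reachable.add_right {m n : Multiset P.S} (h : P.Reachable m n) (k : Multiset P.S) :
    P.Reachable (m + k) (n + k) := by
  induction h with
  | refl => exact .refl _
  | step τ hf _ ih => exact .step τ (hf.add_right k) ih

theorem Reachable.add_left {m n : Multiset P.S} (h : P.Reachable m n) (k : Multiset P.S) :
    P.Reachable (k + m) (k + n) := by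
  simpa only [add_comm k] using h.add_right k

/-- A map of places and transitions compatible with sources and targets preserves firings. -/
theorem Fires.map {Q : PetriNet.{u}} (f : P.T → Q.T) (g : P.S → Q.S)
    (hs : ∀ τ, Q.src (f τ) = (P.src τ).map g) (ht : ∀ τ, Q.tgt (f τ) = (P.tgt τ).map g)
    {τ : P.T} {m n : Multiset P.S} (h : P.Fires τ m n) : Q.Fires (f τ) (m.map g) (n.map g) := by
  refine ⟨hs τ ▸ Multiset.map_le_map h.1, ?_⟩
  rw [hs, ht, ← Multiset.map_add, ← Multiset.map_add, h.2]

theorem Reachable.map {Q : PetriNet.{u}} (f : P.T → Q.T) (g : P.S → Q.S)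
    (hs : ∀ τ, Q.src (f τ) = (P.src τ).map g) (ht : ∀ τ, Q.tgt (f τ) = (P.tgt τ).map g)
    {m n : Multiset P.S} (h : P.Reachable m n) : Q.Reachable (m.map g) (n.map g) := by
  induction h with
  | refl => exact .refl _
  | step τ hf _ ih => exact .step (f τ) (hf.map f g hs ht) ih

/-- A partial map of places, under which each transition of `P` becomes either a transition of `Q`
or trivial, preserves reachability. -/
theorem Reachable.filterMap {Q : PetriNet.{u}} (g : P.S → Option Q.S)
    (hg : ∀ τ, (∃ σ, (P.src τ).filterMap g = Q.src σ ∧ (P.tgt τ).filterMap g = Q.tgt σ) ∨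
      ((P.src τ).filterMap g = 0 ∧ (P.tgt τ).filterMap g = 0))
    {m n : Multiset P.S} (h : P.Reachable m n) :
    Q.Reachable (m.filterMap g) (n.filterMap g) := by
  induction h with
  | refl => exact .refl _
  | step τ hf _ ih =>
    have hle := Multiset.filterMap_le_filterMap g hf.1
    have heq := congrArg (Multiset.filterMap g) hf.2
    rw [Multiset.filterMap_add, Multiset.filterMap_add] at heq
    obtain ⟨σ, hs, ht⟩ | ⟨hs, ht⟩ := hg τ
    · rw [hs] at hle
      rw [hs, ht] at heq
      exact .step σ ⟨hle, heq⟩ ih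
    · rw [hs, ht, add_zero, add_zero] at heq
      exact heq ▸ ih

end PetriNet

/-- Identifying `ℕ[S ⊔ S'] ≅ ℕ[S] × ℕ[S']` by the canonical monoid
isomorphism (whose inverse sends `(m, m')` to `ℕ[inl](m) + ℕ[inr](m')`), a marking
`(n, n')` is reachable from `(m, m')` in `P + P'` if and only if `n` is reachable from `m`
in `P` and `n'` is reachable from `m'` in `P'`. -/
theorem reachable_coprod (P P' : PetriNet.{u})
    (m n : Multiset P.S) (m' n' : Multiset P'.S) :
    (P.coprod P').Reachable (m.map Sum.inl + m'.map Sum.inr) (n.map Sum.inl + n'.map Sum.inr)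
      ↔ P.Reachable m n ∧ P'.Reachable m' n' := by
  constructor
  · intro h
    have hl : P.Reachable ((m.map Sum.inl + m'.map Sum.inr).filterMap Sum.getLeft?)
        ((n.map Sum.inl + n'.map Sum.inr).filterMap Sum.getLeft?) := by
      refine h.filterMap Sum.getLeft? ?_
      rintro (τ | τ)
      · exact .inl ⟨τ, Multiset.filterMap_getLeft?_map_inl _,
          Multiset.filterMap_getLeft?_map_inl _⟩
      · exact .inr ⟨Multiset.filterMap_getLeft?_map_inr _,
          Multiset.filterMap_getLeft?_map_inr _⟩
    have hr : P'.Reachable ((m.map Sum.inl + m'.map Sum.inr).filterMap Sum.getRight?)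
        ((n.map Sum.inl + n'.map Sum.inr).filterMap Sum.getRight?) := by
      refine h.filterMap Sum.getRight? ?_
      rintro (τ | τ)
      · exact .inr ⟨Multiset.filterMap_getRight?_map_inl _,
          Multiset.filterMap_getRight?_map_inl _⟩
      · exact .inl ⟨τ, Multiset.filterMap_getRight?_map_inr _,
          Multiset.filterMap_getRight?_map_inr _⟩
    simp only [Multiset.filterMap_getLeft?_map_inl_add_map_inr] at hl
    simp only [Multiset.filterMap_getRight?_map_inl_add_map_inr] at hr
    exact ⟨hl, hr⟩
  · rintro ⟨h, h'⟩
    have hl := h.map (Q := P.coprod P') Sum.inl Sum.inl (fun _ => rfl) (fun _ => rfl)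
    have hr := h'.map (Q := P.coprod P') Sum.inr Sum.inr (fun _ => rfl) (fun _ => rfl)
    exact (hl.add_right _).trans (hr.add_left _)
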